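/- (Variational structure of the free energy) For every symmetric n×n real matrix A, Ω[A] = inf over symmetric positive definite n×n matrices G of (½ Tr[AG] - 𝓕[G]); that is, Ω is the concave Legendre conjugate of 𝓕 with respect to the pairing ⟨A,G⟩ = ½ Tr[AG]. -/

import Mathlib

open MeasureTheory Matrix Filter Topology Real Asymptotics

attribute [local instance] Matrix.normedAddCommGroup Matrix.normedSpace

noncomputable section

/-- The partition function `Z[A] = ∫ exp(-½ xᵀAx - U(x)) dx`. -/
def Zfun (n : ℕ) (U : (Fin n → ℝ) → ℝ) (A : Matrix (Fin n) (Fin n) ℝ) : ℝ :=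
  ∫ x : Fin n → ℝ, Real.exp (-(1 / 2) * (x ⬝ᵥ A.mulVec x) - U x)

/-- The free energy `Ω[A] = -log Z[A]`. -/
def Omega (n : ℕ) (U : (Fin n → ℝ) → ℝ) (A : Matrix (Fin n) (Fin n) ℝ) : ℝ :=
  - Real.log (Zfun n U A)

/-- `U` is continuous with superquadratic growth: for every `c > 0`,
`U x - c * |x|² → +∞` as `|x| → ∞`. -/
def SuperQuadratic {n : ℕ} (U : (Fin n → ℝ) → ℝ) : Prop :=
  Continuous U ∧ ∀ c : ℝ, 0 < c →
    Tendsto (fun x : Fin n → ℝ => U x - c * ‖x‖ ^ 2) (cocompact _) atTop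

/-- A probability density on `ℝⁿ` with finite second moments and finite
differential entropy. -/
def IsGoodDensity {n : ℕ} (ρ : (Fin n → ℝ) → ℝ) : Prop :=
  Measurable ρ ∧ (∀ x, 0 ≤ ρ x) ∧ (∫ x, ρ x) = 1 ∧
  (∀ i j : Fin n, Integrable fun x => x i * x j * ρ x) ∧
  Integrable fun x => ρ x * Real.log (ρ x)

/-- Differential entropy `S(ρ) = -∫ ρ log ρ`. -/
def entropy {n : ℕ} (ρ : (Fin n → ℝ) → ℝ) : ℝ := - ∫ x, ρ x * Real.log (ρ x)

/-- Second-moment matrix `𝒢(ρ) = ∫ x xᵀ ρ(x) dx`. -/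
def momMatrix {n : ℕ} (ρ : (Fin n → ℝ) → ℝ) : Matrix (Fin n) (Fin n) ℝ :=
  Matrix.of fun i j => ∫ x, x i * x j * ρ x

/-- `𝓕[G;U] = sup { S(ρ) - ∫ U ρ : ρ ∈ 𝓜, 𝒢(ρ) = G }`. -/
def Ffun (n : ℕ) (U : (Fin n → ℝ) → ℝ) (G : Matrix (Fin n) (Fin n) ℝ) : ℝ :=
  sSup { r : ℝ | ∃ ρ : (Fin n → ℝ) → ℝ, IsGoodDensity ρ ∧
    (Integrable fun x => U x * ρ x) ∧ momMatrix ρ = G ∧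
    r = entropy ρ - ∫ x, U x * ρ x }

/-- The Luttinger-Ward functional `Φ[G;U] = 2𝓕[G;U] - Tr[log G] - n log(2πe)`.
(For positive definite `G`, `Tr[log G] = log det G`.) -/
def Phi (n : ℕ) (U : (Fin n → ℝ) → ℝ) (G : Matrix (Fin n) (Fin n) ℝ) : ℝ :=
  2 * Ffun n U G - Real.log G.det - (n : ℝ) * Real.log (2 * π * Real.exp 1)

/-- The continuous linear functional `H ↦ Tr[S * H]` on matrices. -/
def tracePairing {n : ℕ} (S : Matrix (Fin n) (Fin n) ℝ) :
    Matrix (Fin n) (Fin n) ℝ →L[ℝ] ℝ :=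
  LinearMap.toContinuousLinearMap
    { toFun := fun H => (S * H).trace
      map_add' := fun H K => by simp [Matrix.mul_add]
      map_smul' := fun c H => by simp [Matrix.mul_smul] }

lemma quad_abs {n : ℕ} (A : Matrix (Fin n) (Fin n) ℝ) (x : Fin n → ℝ) :
    |x ⬝ᵥ A.mulVec x| ≤ (∑ i, ∑ j, |A i j|) * ‖x‖ ^ 2 := by
  simp only [dotProduct, mulVec, Finset.mul_sum, Finset.sum_mul]
  refine (Finset.abs_sum_le_sum_abs _ _).trans (Finset.sum_le_sum fun i _ => ?_)
  refine (Finset.abs_sum_le_sum_abs _ _).trans (Finset.sum_le_sum fun j _ => ?_)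
  rw [abs_mul, abs_mul]
  have h1 : |x i| ≤ ‖x‖ := norm_le_pi_norm x i
  have h2 : |x j| ≤ ‖x‖ := norm_le_pi_norm x j
  have : |x i| * |x j| ≤ ‖x‖ * ‖x‖ := mul_le_mul h1 h2 (abs_nonneg _) (norm_nonneg _)
  nlinarith [abs_nonneg (A i j)]

lemma sumsq_le {n : ℕ} (x : Fin n → ℝ) : ∑ i, x i ^ 2 ≤ n * ‖x‖ ^ 2 := by
  calc ∑ i, x i ^ 2 ≤ ∑ i : Fin n, ‖x‖ ^ 2 := by
        refine Finset.sum_le_sum fun i _ => ?_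
        have h1 : |x i| ≤ ‖x‖ := norm_le_pi_norm x i
        rw [← sq_abs]
        gcongr
    _ = _ := by simp

lemma gauss_int (n : ℕ) : Integrable fun x : Fin n → ℝ => Real.exp (-∑ i, x i ^ 2) := by
  have h := Integrable.fintype_prod (ι := Fin n) (μ := fun _ => (volume : Measure ℝ))
    (f := fun _ x => Real.exp (-1 * x ^ 2))
    (fun _ => integrable_exp_neg_mul_sq one_pos)
  refine h.congr (Eventually.of_forall fun x => ?_)
  simp [← Real.exp_sum]

def Vf {n : ℕ} (U : (Fin n → ℝ) → ℝ) (A : Matrix (Fin n) (Fin n) ℝ) (x : Fin n → ℝ) : ℝ :=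
  (1 / 2) * (x ⬝ᵥ A.mulVec x) + U x

lemma Vf_cont {n : ℕ} {U : (Fin n → ℝ) → ℝ} (hU : Continuous U)
    (A : Matrix (Fin n) (Fin n) ℝ) : Continuous (Vf U A) := by
  unfold Vf
  have : Continuous fun x : Fin n → ℝ => x ⬝ᵥ A.mulVec x := by
    simp only [dotProduct, mulVec]
    fun_prop
  fun_prop

lemma Vf_lower {n : ℕ} {U : (Fin n → ℝ) → ℝ} (hU : SuperQuadratic U)
    (A : Matrix (Fin n) (Fin n) ℝ) :
    ∃ K : ℝ, ∀ x, 2 * ∑ i, x i ^ 2 ≤ Vf U A x + K := by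
  set C := ∑ i, ∑ j, |A i j| with hC
  have hC0 : 0 ≤ C := Finset.sum_nonneg fun i _ => Finset.sum_nonneg fun j _ => abs_nonneg _
  obtain ⟨hc, ht⟩ := hU
  have hcont : Continuous fun x : Fin n → ℝ => U x - (C + 2 * n + 1) * ‖x‖ ^ 2 := by fun_prop
  obtain ⟨x0, hx0⟩ := hcont.exists_forall_le (ht (C + 2 * n + 1) (by positivity))
  refine ⟨-(U x0 - (C + 2 * n + 1) * ‖x0‖ ^ 2), fun x => ?_⟩
  have h1 := hx0 x
  have h2 := sumsq_le x
  have h3 := neg_abs_le (x ⬝ᵥ A.mulVec x)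
  have h4 := quad_abs A x
  rw [← hC] at h4
  unfold Vf
  have : 0 ≤ C * ‖x‖ ^ 2 := by positivity
  nlinarith [sq_nonneg ‖x‖]

lemma w_int {n : ℕ} {U : (Fin n → ℝ) → ℝ} (hU : SuperQuadratic U)
    (A : Matrix (Fin n) (Fin n) ℝ) (f : (Fin n → ℝ) → ℝ) (hf : Continuous f) (a b : ℝ)
    (hfb : ∀ x, |f x| ≤ a * |Vf U A x| + b + a * ∑ i, x i ^ 2) (ha : 0 ≤ a) (hb : 0 ≤ b) :
    Integrable fun x => f x * Real.exp (-Vf U A x) := by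
  obtain ⟨K, hK⟩ := Vf_lower hU A
  have hV := Vf_cont hU.1 A
  have hg := (gauss_int n).const_mul ((a * (2 + |K| + 1) + b) * Real.exp K)
  refine hg.mono' (by fun_prop) (Eventually.of_forall fun x => ?_)
  set q := ∑ i, x i ^ 2 with hq
  have hq0 : 0 ≤ q := Finset.sum_nonneg fun i _ => sq_nonneg _
  set V := Vf U A x
  have hKx : 2 * q ≤ V + K := hK x
  rw [norm_mul, Real.norm_eq_abs, Real.norm_eq_abs, Real.abs_exp]
  set y := (V + K) / 2 with hy
  have hVy : V = 2 * y - K := by rw [hy]; ring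
  have hqy : q ≤ y := by rw [hy]; linarith
  have hy1 : y + 1 ≤ Real.exp y := Real.add_one_le_exp y
  have h1y : 1 ≤ Real.exp y := by linarith
  have e1 : Real.exp (-V) = Real.exp K * Real.exp (-y) * Real.exp (-y) := by
    rw [← Real.exp_add, ← Real.exp_add]; congr 1; rw [hVy]; ring
  have e2 : Real.exp (-y) ≤ Real.exp (-q) := Real.exp_le_exp.2 (by linarith)
  have e3 : Real.exp y * Real.exp (-y) = 1 := by rw [← Real.exp_add]; simp
  have hVa : |V| ≤ 2 * y + |K| := by
    rw [hVy]; refine (abs_sub _ _).trans ?_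
    rw [abs_of_nonneg (by linarith : 0 ≤ 2 * y)]
  have hfx : |f x| ≤ (a * (2 + |K| + 1) + b) * Real.exp y := by
    have t1 : a * |V| ≤ a * (2 * Real.exp y + |K| * Real.exp y) := by
      apply mul_le_mul_of_nonneg_left _ ha
      nlinarith [abs_nonneg K]
    have t2 : a * q ≤ a * Real.exp y := by
      apply mul_le_mul_of_nonneg_left _ ha
      linarith
    have t3 : b ≤ b * Real.exp y := by nlinarith
    have := hfb x
    linarith
  calc |f x| * Real.exp (-V) ≤ ((a * (2 + |K| + 1) + b) * Real.exp y) *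
        (Real.exp K * Real.exp (-y) * Real.exp (-y)) := by
        rw [e1]; gcongr
    _ = ((a * (2 + |K| + 1) + b) * Real.exp K) * Real.exp (-y) * (Real.exp y * Real.exp (-y)) := by
        ring
    _ ≤ _ := by rw [e3, mul_one]; gcongr

lemma Z_eq {n : ℕ} (U : (Fin n → ℝ) → ℝ) (A : Matrix (Fin n) (Fin n) ℝ) :
    Zfun n U A = ∫ x, Real.exp (-Vf U A x) := by
  unfold Zfun Vf
  congr 1; ext x; congr 1; ring

lemma w_int0 {n : ℕ} {U : (Fin n → ℝ) → ℝ} (hU : SuperQuadratic U)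
    (A : Matrix (Fin n) (Fin n) ℝ) : Integrable fun x => Real.exp (-Vf U A x) := by
  have := w_int hU A (fun _ => 1) continuous_const 0 1 (by simp) le_rfl zero_le_one
  simpa using this

lemma Z_pos {n : ℕ} {U : (Fin n → ℝ) → ℝ} (hU : SuperQuadratic U)
    (A : Matrix (Fin n) (Fin n) ℝ) : 0 < Zfun n U A := by
  rw [Z_eq]; exact integral_exp_pos (w_int0 hU A)

lemma gibbs_pt {t : ℝ} (ht : 0 ≤ t) (s : ℝ) : t * s + t - Real.exp s ≤ t * Real.log t := by
  rcases ht.eq_or_lt with rfl | h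
  · simp [Real.exp_nonneg]
  · have h1 := Real.add_one_le_exp (s - Real.log t)
    rw [Real.exp_sub, Real.exp_log h, le_div_iff₀ h] at h1
    nlinarith

lemma quad_mom {n : ℕ} {ρ : (Fin n → ℝ) → ℝ}
    (h : ∀ i j : Fin n, Integrable fun x => x i * x j * ρ x) (A : Matrix (Fin n) (Fin n) ℝ) :
    Integrable (fun x => (x ⬝ᵥ A.mulVec x) * ρ x) ∧
      ∫ x, (x ⬝ᵥ A.mulVec x) * ρ x = (A * momMatrix ρ).trace := by
  have e : (fun x : Fin n → ℝ => (x ⬝ᵥ A.mulVec x) * ρ x) =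
      fun x => ∑ i, ∑ j, A i j * (x j * x i * ρ x) := by
    ext x
    simp only [dotProduct, mulVec, Finset.mul_sum, Finset.sum_mul]
    refine Finset.sum_congr rfl fun i _ => Finset.sum_congr rfl fun j _ => by ring
  have hi : ∀ i j, Integrable fun x : Fin n → ℝ => A i j * (x j * x i * ρ x) :=
    fun i j => (h j i).const_mul _
  rw [e]
  refine ⟨integrable_finsetSum _ fun i _ => integrable_finsetSum _ fun j _ => hi i j, ?_⟩
  rw [integral_finsetSum _ fun i _ => integrable_finsetSum _ fun j _ => hi i j]
  simp only [Matrix.trace, Matrix.diag, Matrix.mul_apply, momMatrix, Matrix.of_apply]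
  refine Finset.sum_congr rfl fun i _ => ?_
  rw [integral_finsetSum _ fun j _ => hi i j]
  refine Finset.sum_congr rfl fun j _ => integral_const_mul _ _

lemma dens_int {n : ℕ} {ρ : (Fin n → ℝ) → ℝ} (h : (∫ x, ρ x) = 1) : Integrable ρ := by
  by_contra hc
  rw [integral_undef hc] at h
  exact zero_ne_one h

lemma gibbs {n : ℕ} {U : (Fin n → ℝ) → ℝ} (hU : SuperQuadratic U)
    (A : Matrix (Fin n) (Fin n) ℝ) {ρ : (Fin n → ℝ) → ℝ} (hρ : IsGoodDensity ρ)
    (hUρ : Integrable fun x => U x * ρ x) :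
    entropy ρ - ∫ x, U x * ρ x ≤ (1 / 2) * (A * momMatrix ρ).trace - Omega n U A := by
  obtain ⟨hm, h0, h1, h2, h3⟩ := hρ
  have hi := dens_int h1
  obtain ⟨q1, q2⟩ := quad_mom h2 A
  have hZ := Z_pos hU A
  have hw := w_int0 hU A
  set L := Real.log (Zfun n U A) with hL
  have hpt : ∀ x, -((1 / 2) * ((x ⬝ᵥ A.mulVec x) * ρ x) + U x * ρ x) + (1 - L) * ρ x -
      (Zfun n U A)⁻¹ * Real.exp (-Vf U A x) ≤ ρ x * Real.log (ρ x) := by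
    intro x
    have := gibbs_pt (h0 x) (-Vf U A x - L)
    rw [Real.exp_sub, hL, Real.exp_log hZ, ← hL] at this
    refine le_trans (le_of_eq ?_) this
    unfold Vf
    ring
  have i1 := (q1.const_mul (1 / 2)).add hUρ
  have i2 := hi.const_mul (1 - L)
  have i3 := hw.const_mul (Zfun n U A)⁻¹
  have key := integral_mono ((i1.neg.add i2).sub i3) h3 hpt
  rw [integral_sub' (i1.neg.add i2) i3, integral_add' i1.neg i2, integral_neg',
    integral_add' (q1.const_mul (1 / 2)) hUρ, integral_const_mul, integral_const_mul,
    integral_const_mul, q2, h1, ← Z_eq, inv_mul_cancel₀ hZ.ne'] at key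
  unfold entropy Omega
  rw [← hL]
  linarith

lemma mom_posDef {n : ℕ} {ρ : (Fin n → ℝ) → ℝ} (hc : Continuous ρ) (hp : ∀ x, 0 < ρ x)
    (h : ∀ i j : Fin n, Integrable fun x => x i * x j * ρ x) : (momMatrix ρ).PosDef := by
  have hs : (momMatrix ρ).IsHermitian := by
    ext i j
    simp only [momMatrix, Matrix.conjTranspose_apply, Matrix.of_apply, star_trivial]
    congr 1; ext x; ring
  refine Matrix.PosDef.of_dotProduct_mulVec_pos hs fun v hv => ?_
  have hvv : 0 < v ⬝ᵥ v := by
    have := Matrix.dotProduct_star_self_pos_iff.2 hv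
    simpa using this
  have e : star v ⬝ᵥ (momMatrix ρ).mulVec v = ∫ x, (v ⬝ᵥ x) ^ 2 * ρ x ∧
      Integrable fun x => (v ⬝ᵥ x) ^ 2 * ρ x := by
    have hq := quad_mom h (Matrix.vecMulVec v v)
    have e1 : (fun x : Fin n → ℝ => (x ⬝ᵥ (Matrix.vecMulVec v v).mulVec x) * ρ x) =
        fun x => (v ⬝ᵥ x) ^ 2 * ρ x := by
      ext x
      rw [Matrix.vecMulVec_mulVec, dotProduct_comm v x]
      simp [dotProduct_smul]
      left
      ring
    rw [e1] at hq
    refine ⟨?_, hq.1⟩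
    rw [hq.2, star_trivial, Matrix.trace_mul_comm, Matrix.mul_vecMulVec, Matrix.trace_vecMulVec,
      dotProduct_comm]
  rw [e.1]
  rw [integral_pos_iff_support_of_nonneg (fun x => mul_nonneg (sq_nonneg _) (hp x).le) e.2]
  have hcont : Continuous fun x : Fin n → ℝ => (v ⬝ᵥ x) ^ 2 * ρ x := by
    simp only [dotProduct]; fun_prop
  refine hcont.isOpen_support.measure_pos _ ⟨v, ?_⟩
  simp only [Function.mem_support]
  exact (mul_pos (pow_pos hvv 2) (hp v)).ne'

lemma gibbs_state {n : ℕ} {U : (Fin n → ℝ) → ℝ} (hU : SuperQuadratic U)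
    (A : Matrix (Fin n) (Fin n) ℝ) :
    ∃ ρ : (Fin n → ℝ) → ℝ, IsGoodDensity ρ ∧ (Integrable fun x => U x * ρ x) ∧
      (momMatrix ρ).PosDef ∧
      entropy ρ - ∫ x, U x * ρ x = (1 / 2) * (A * momMatrix ρ).trace - Omega n U A := by
  have hZ := Z_pos hU A
  have hw := w_int0 hU A
  have hV := Vf_cont hU.1 A
  set L := Real.log (Zfun n U A) with hL
  set ρ : (Fin n → ℝ) → ℝ := fun x => Real.exp (-Vf U A x) * (Zfun n U A)⁻¹ with hρ
  have hc : Continuous ρ := by fun_prop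
  have hp : ∀ x, 0 < ρ x := fun x => by positivity
  have h1 : ∫ x, ρ x = 1 := by
    rw [hρ, integral_mul_const, ← Z_eq, mul_inv_cancel₀ hZ.ne']
  have hlog : ∀ x, Real.log (ρ x) = -Vf U A x - L := fun x => by
    rw [hρ]
    simp only
    rw [Real.log_mul (Real.exp_pos _).ne' (inv_pos.2 hZ).ne', Real.log_exp, Real.log_inv]
    ring
  have hVi : Integrable fun x => Vf U A x * ρ x := by
    have := (w_int hU A (Vf U A) hV 1 0 (fun x => by
      have : 0 ≤ ∑ i, x i ^ 2 := Finset.sum_nonneg fun i _ => sq_nonneg _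
      linarith) zero_le_one le_rfl).mul_const (Zfun n U A)⁻¹
    refine this.congr (Eventually.of_forall fun x => ?_)
    simp only [hρ]; ring
  have h2 : ∀ i j : Fin n, Integrable fun x => x i * x j * ρ x := fun i j => by
    have := (w_int hU A (fun x => x i * x j) (by fun_prop) 1 0 (fun x => by
      have h1 : x i ^ 2 ≤ ∑ i, x i ^ 2 :=
        Finset.single_le_sum (f := fun i => x i ^ 2) (fun i _ => sq_nonneg _) (Finset.mem_univ i)
      have h2 : x j ^ 2 ≤ ∑ i, x i ^ 2 :=
        Finset.single_le_sum (f := fun i => x i ^ 2) (fun i _ => sq_nonneg _) (Finset.mem_univ j)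
      have h3 := abs_nonneg (Vf U A x)
      have h4 : |x i * x j| ≤ (x i ^ 2 + x j ^ 2) / 2 := by
        rw [abs_mul]
        nlinarith [sq_nonneg (|x i| - |x j|), sq_abs (x i), sq_abs (x j)]
      linarith) zero_le_one le_rfl).mul_const (Zfun n U A)⁻¹
    refine this.congr (Eventually.of_forall fun x => ?_)
    simp only [hρ]; ring
  have hi := dens_int h1
  have h3e : (fun x => ρ x * Real.log (ρ x)) = fun x => -(Vf U A x * ρ x) - L * ρ x := by
    ext x; rw [hlog]; ring
  have h3 : Integrable fun x => ρ x * Real.log (ρ x) := by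
    rw [h3e]; exact hVi.neg.sub (hi.const_mul L)
  obtain ⟨q1, q2⟩ := quad_mom h2 A
  have hUe : (fun x => U x * ρ x) =
      fun x => Vf U A x * ρ x - (1 / 2) * ((x ⬝ᵥ A.mulVec x) * ρ x) := by
    ext x; unfold Vf; ring
  refine ⟨ρ, ⟨hc.measurable, fun x => (hp x).le, h1, h2, h3⟩, ?_, mom_posDef hc hp h2, ?_⟩
  · rw [hUe]; exact hVi.sub (q1.const_mul _)
  · unfold entropy Omega
    have hVn : Integrable fun x => -(Vf U A x * ρ x) := hVi.neg
    rw [h3e, hUe, integral_sub hVn (hi.const_mul L), integral_sub hVi (q1.const_mul _),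
      integral_neg, integral_const_mul, integral_const_mul, q2, h1]
    ring

lemma fact_posDef {n : ℕ} {G : Matrix (Fin n) (Fin n) ℝ} (hG : G.PosDef) :
    ∃ B : Matrix (Fin n) (Fin n) ℝ, B.det ≠ 0 ∧ G = B * Bᵀ := by
  obtain ⟨m, v, hv⟩ : ∃ B : Matrix (Fin n) (Fin n) ℝ, G = B * Bᵀ := by
    set H := hG.1
    refine ⟨(H.eigenvectorUnitary : Matrix (Fin n) (Fin n) ℝ) *
      Matrix.diagonal (fun i => Real.sqrt (H.eigenvalues i)), ?_⟩
    conv_lhs => rw [H.spectral_theorem]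
    rw [Unitary.conjStarAlgAut_apply, Matrix.transpose_mul, Matrix.diagonal_transpose,
      ← Matrix.mul_assoc, Matrix.mul_assoc _ (Matrix.diagonal _) (Matrix.diagonal _),
      Matrix.diagonal_mul_diagonal]
    congr 3
    ext i
    simp [Real.mul_self_sqrt (hG.eigenvalues_pos i).le]
  refine ⟨m, ?_, rfl⟩
  intro h0
  have := hG.det_pos
  rw [Matrix.det_mul, h0] at this
  simp at this

lemma int_pow_Icc (k : ℕ) : ∫ x in Set.Icc (-1 : ℝ) 1, x ^ k = (1 - (-1) ^ (k + 1)) / (k + 1) := by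
  rw [integral_Icc_eq_integral_Ioc, ← intervalIntegral.integral_of_le (by norm_num), integral_pow]
  simp

def cube (n : ℕ) : Set (Fin n → ℝ) := Set.univ.pi fun _ => Set.Icc (-1) 1

lemma cube_prod (n : ℕ) (e : Fin n → ℕ) :
    ∫ x in cube n, ∏ k, x k ^ e k = ∏ k, (1 - (-1 : ℝ) ^ (e k + 1)) / ((e k : ℝ) + 1) := by
  rw [cube, volume_pi, Measure.restrict_pi_pi,
    integral_fintype_prod_eq_prod (fun k (x : ℝ) => x ^ e k)]
  simp_rw [int_pow_Icc]

lemma cube_one (n : ℕ) : ∫ _ in cube n, (1 : ℝ) = 2 ^ n := by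
  have := cube_prod n (fun _ => 0)
  norm_num at this
  simpa using this

lemma cube_mom (n : ℕ) (i j : Fin n) :
    ∫ x in cube n, x i * x j = if i = j then 2 ^ n / 3 else 0 := by
  have := cube_prod n (fun k => (if k = i then 1 else 0) + (if k = j then 1 else 0))
  have e : ∀ x : Fin n → ℝ,
      ∏ k, x k ^ ((if k = i then 1 else 0) + (if k = j then 1 else 0)) = x i * x j := by
    intro x
    simp_rw [pow_add, Finset.prod_mul_distrib]
    simp
  simp_rw [e] at this
  rw [this]
  split_ifs with hij
  · subst hij
    have : ∀ k : Fin n, (1 - (-1 : ℝ) ^ ((if k = i then 1 else 0) + (if k = i then 1 else 0) + 1)) /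
      ((((if k = i then 1 else 0) + (if k = i then 1 else 0) : ℕ) : ℝ) + 1) =
        2 * (if k = i then 1 / 3 else 1) := by
      intro k
      split_ifs <;> norm_num
    simp_rw [this, Finset.prod_mul_distrib]
    simp
    ring
  · refine Finset.prod_eq_zero (Finset.mem_univ i) ?_
    simp [hij]

lemma exists_density {n : ℕ} {U : (Fin n → ℝ) → ℝ} (hU : Continuous U)
    {G : Matrix (Fin n) (Fin n) ℝ} (hG : G.PosDef) :
    ∃ ρ : (Fin n → ℝ) → ℝ, IsGoodDensity ρ ∧ (Integrable fun x => U x * ρ x) ∧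
      momMatrix ρ = G := by
  obtain ⟨B, hB, hGB⟩ := fact_posDef (hG.smul (show (0 : ℝ) < 3 by norm_num))
  set f : (Fin n → ℝ) →L[ℝ] (Fin n → ℝ) := LinearMap.toContinuousLinearMap (Matrix.toLin' B)
  have hfx : ∀ x, f x = B.mulVec x := fun x => Matrix.toLin'_apply B x
  have hdet : f.det = B.det := LinearMap.det_toLin' B
  have hinj : Function.Injective f := by
    intro x y hxy
    rw [hfx, hfx] at hxy
    exact Matrix.mulVec_injective_of_isUnit ((Matrix.isUnit_iff_isUnit_det B).2 hB.isUnit) hxy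
  have hCc : IsCompact (cube n) := isCompact_univ_pi fun _ => isCompact_Icc
  have hSc : IsCompact (f '' cube n) := hCc.image f.continuous
  set S := f '' cube n with hS
  have hSm : MeasurableSet S := hSc.isClosed.measurableSet
  have hcv : ∀ g : (Fin n → ℝ) → ℝ, ∫ x in S, g x = |B.det| * ∫ x in cube n, g (f x) := by
    intro g
    rw [hS, integral_image_eq_integral_abs_det_fderiv_smul volume hCc.isClosed.measurableSet
      (fun x _ => f.hasFDerivWithinAt) hinj.injOn g, hdet]
    simp only [smul_eq_mul]
    rw [integral_const_mul]
  have hd : 0 < |B.det| := abs_pos.2 hB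
  set c : ℝ := (2 ^ n * |B.det|)⁻¹ with hc
  have hc0 : 0 < c := by positivity
  set ρ : (Fin n → ℝ) → ℝ := S.indicator fun _ => c with hρ
  have hmul : ∀ g : (Fin n → ℝ) → ℝ, (fun x => g x * ρ x) = S.indicator fun x => g x * c := by
    intro g; ext x; by_cases hx : x ∈ S <;> simp [hρ, hx]
  have hint : ∀ g : (Fin n → ℝ) → ℝ, Continuous g → Integrable fun x => g x * ρ x := by
    intro g hg
    rw [hmul, integrable_indicator_iff hSm]
    exact (hg.mul continuous_const).continuousOn.integrableOn_compact hSc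
  have hval : ∀ g : (Fin n → ℝ) → ℝ, ∫ x, g x * ρ x = (2 ^ n)⁻¹ * ∫ x in cube n, g (f x) := by
    intro g
    rw [hmul, integral_indicator hSm, integral_mul_const, hcv, hc]
    field_simp
  have hlog : (fun x => ρ x * Real.log (ρ x)) = fun x => Real.log c * ρ x := by
    ext x; by_cases hx : x ∈ S <;> simp [hρ, hx, mul_comm]
  refine ⟨ρ, ⟨measurable_const.indicator hSm, fun x => Set.indicator_nonneg (fun _ _ => hc0.le) x,
    ?_, fun i j => hint _ (by fun_prop), ?_⟩, hint U hU, ?_⟩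
  · have := hval (fun _ => 1)
    rw [cube_one] at this
    simpa using this
  · rw [hlog]; exact hint _ continuous_const
  · ext i j
    simp only [momMatrix, Matrix.of_apply]
    rw [hval (fun x => x i * x j)]
    have e : ∀ x, f x i * f x j = ∑ k, ∑ l, (B i k * B j l) * (x k * x l) := by
      intro x
      rw [hfx]
      simp only [mulVec, dotProduct, Finset.sum_mul_sum]
      exact Finset.sum_congr rfl fun k _ => Finset.sum_congr rfl fun l _ => by ring
    have hi : ∀ k l, IntegrableOn (fun x : Fin n → ℝ => (B i k * B j l) * (x k * x l)) (cube n) :=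
      fun k l => (by fun_prop : Continuous fun x : Fin n → ℝ =>
        (B i k * B j l) * (x k * x l)).continuousOn.integrableOn_compact hCc
    simp_rw [e]
    rw [integral_finsetSum _ fun k _ => integrable_finsetSum _ fun l _ => hi k l]
    have e2 : ∀ k, ∫ x in cube n, ∑ l, (B i k * B j l) * (x k * x l) =
        B i k * B j k * (2 ^ n / 3) := by
      intro k
      rw [integral_finsetSum _ fun l _ => hi k l]
      simp_rw [integral_const_mul, cube_mom]
      simp
    simp_rw [e2]
    have hij : 3 * G i j = ∑ k, B i k * B j k := by
      have := congrFun (congrFun hGB i) j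
      simpa [Matrix.mul_apply] using this
    rw [← Finset.sum_mul, ← hij]
    field_simp

/-- Variational structure of the free energy: for every symmetric `A`,
`Ω[A] = inf_{G ≻ 0} (½ Tr[AG] - 𝓕[G])`, i.e. `Ω` is the concave Legendre conjugate of
`𝓕` with respect to the pairing `⟨A,G⟩ = ½ Tr[AG]`. -/
theorem statement3 (n : ℕ) (hn : 1 ≤ n) (U : (Fin n → ℝ) → ℝ) (hU : SuperQuadratic U)
    (A : Matrix (Fin n) (Fin n) ℝ) (hA : A.IsSymm) :
    Omega n U A = sInf { r : ℝ | ∃ G : Matrix (Fin n) (Fin n) ℝ, G.PosDef ∧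
      r = (1 / 2) * (A * G).trace - Ffun n U G } := by
  set Sx : Matrix (Fin n) (Fin n) ℝ → Set ℝ := fun G => { r : ℝ | ∃ ρ : (Fin n → ℝ) → ℝ,
    IsGoodDensity ρ ∧ (Integrable fun x => U x * ρ x) ∧ momMatrix ρ = G ∧
    r = entropy ρ - ∫ x, U x * ρ x } with hSx
  have hub : ∀ G, ∀ r ∈ Sx G, r ≤ (1 / 2) * (A * G).trace - Omega n U A := by
    rintro G r ⟨ρ, h1, h2, rfl, rfl⟩
    exact gibbs hU A h1 h2
  have hF : ∀ G, Ffun n U G = sSup (Sx G) := fun G => rfl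
  have hlow : ∀ G : Matrix (Fin n) (Fin n) ℝ, G.PosDef →
      Ffun n U G ≤ (1 / 2) * (A * G).trace - Omega n U A := by
    intro G hG
    obtain ⟨ρ, h1, h2, h3⟩ := exists_density hU.1 hG
    rw [hF]
    exact csSup_le ⟨_, ρ, h1, h2, h3, rfl⟩ (hub G)
  symm
  refine IsLeast.csInf_eq ⟨?_, ?_⟩
  · obtain ⟨ρ, h1, h2, h3, h4⟩ := gibbs_state hU A
    refine ⟨momMatrix ρ, h3, ?_⟩
    have := hlow _ h3
    have h5 : entropy ρ - ∫ x, U x * ρ x ≤ Ffun n U (momMatrix ρ) := by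
      rw [hF]
      exact le_csSup ⟨_, hub _⟩ ⟨ρ, h1, h2, rfl, rfl⟩
    linarith
  · rintro r ⟨G, hG, rfl⟩
    have := hlow G hG
    linarith
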